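/- Fix integers q ≥ 1 and m ≥ 2, and scalings K_n ≤ P_n (positive integers) and p_n ∈ (0,1], with K_n → ∞, K_n²/P_n → 0, and (n·p_{e,q}(n) − ln n)/ln ln n bounded, where p_{e,q}(n) = p_n·(1 − Σ_{u=0}^{q−1} [C(K_n,u)·C(P_n−K_n,K_n−u)/C(P_n,K_n)]). Let S_1, …, S_m be independent uniformly random K_n-element subsets of a key pool of size P_n. Then E[ exp( (n·p_{e,q}(n)·p_n/K_n) · Σ_{1≤i<j≤m} |S_i ∩ S_j| ) ] ≤ 1 + o(1) as n → ∞; i.e., the limsup of this expectation is at most 1. -/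

import Mathlib

open Finset Filter

/-- Weight of a single key ring: uniform over the `K`-element subsets of a
pool of size `P`. -/
noncomputable def ringWeight (K P : ℕ) (S : Finset (Fin P)) : ℝ :=
  if S.card = K then ((P.choose K : ℝ))⁻¹ else 0

/-- `p_{s,q}`: the probability that two key rings share at least `q` keys. -/
noncomputable def psq (q K P : ℕ) : ℝ :=
  1 - ∑ u ∈ Finset.range q,
    ((K.choose u : ℝ) * ((P - K).choose (K - u) : ℝ)) / (P.choose K : ℝ)

/-- `p_{e,q}`: the probability of a secure link. -/
noncomputable def peq (q K P : ℕ) (p : ℝ) : ℝ := p * psq q K P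

/-- The expectation `E[exp((n p_{e,q}(n) p_n / K_n) · Σ_{1≤i<j≤m} |S_i ∩ S_j|)]`,
where `S_1, …, S_m` are independent uniform `K_n`-subsets of a pool of size
`P_n`. -/
noncomputable def expExpectation (q m : ℕ) (K P : ℕ → ℕ) (p : ℕ → ℝ) (n : ℕ) : ℝ :=
  ∑ f : Fin m → Finset (Fin (P n)),
    (∏ i : Fin m, ringWeight (K n) (P n) (f i)) *
      Real.exp (((n : ℝ) * peq q (K n) (P n) (p n) * p n / (K n : ℝ)) *
        ∑ pr ∈ Finset.univ.filter (fun pr : Fin m × Fin m => pr.1 < pr.2),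
          ((f pr.1 ∩ f pr.2).card : ℝ))

theorem choose_le_pow_mul_choose_add (ρ : ℝ) (hρ0 : 0 ≤ ρ) (hρ1 : ρ ≤ 1) (j P K : ℕ)
    (h : ((K + j : ℕ) : ℝ) ≤ ρ * ((P + j : ℕ) : ℝ)) :
    (P.choose K : ℝ) ≤ ρ ^ j * ((P + j).choose (K + j) : ℝ) := by
  induction j with
  | zero => simp
  | succ j ih =>
    have h' : ((K + j : ℕ) : ℝ) ≤ ρ * ((P + j : ℕ) : ℝ) := by
      push_cast at h ⊢
      nlinarith
    refine (ih h').trans ?_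
    rw [pow_succ, mul_assoc]
    refine mul_le_mul_of_nonneg_left ?_ (by positivity)
    have e : (((P + j : ℕ) : ℝ) + 1) * ((P + j).choose (K + j) : ℝ)
        = ((P + (j + 1)).choose (K + (j + 1)) : ℝ) * (((K + j : ℕ) : ℝ) + 1) := by
      exact_mod_cast Nat.add_one_mul_choose_eq (P + j) (K + j)
    have hpos : (0 : ℝ) < ((P + j : ℕ) : ℝ) + 1 := by positivity
    have hc : (0 : ℝ) ≤ ((P + (j + 1)).choose (K + (j + 1)) : ℝ) := by positivity
    have h2 : ((K + j : ℕ) : ℝ) + 1 ≤ ρ * (((P + j : ℕ) : ℝ) + 1) := by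
      push_cast at h ⊢
      linarith
    refine le_of_mul_le_mul_left ?_ hpos
    rw [e]
    nlinarith [mul_le_mul_of_nonneg_left h2 hc]

theorem sum_ringWeight {K P : ℕ} (hKP : K ≤ P) :
    ∑ S : Finset (Fin P), ringWeight K P S = 1 := by
  have hc : (P.choose K : ℝ) ≠ 0 := by exact_mod_cast (Nat.choose_pos hKP).ne'
  have : (Finset.univ.filter fun S : Finset (Fin P) => S.card = K)
      = Finset.powersetCard K Finset.univ := by
    ext S
    simp [Finset.mem_powersetCard]
  simp [ringWeight, ← Finset.sum_filter, this, hc]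

theorem ringWeight_nonneg (K P : ℕ) (S : Finset (Fin P)) : 0 ≤ ringWeight K P S := by
  unfold ringWeight
  split_ifs <;> positivity

/-- A fixed set `A` of keys is contained in a random key ring with probability at most
`(K / P) ^ #A`. -/
theorem sum_ringWeight_superset_le {K P : ℕ} (hP : 0 < P) (hKP : K ≤ P) (A : Finset (Fin P)) :
    ∑ S : Finset (Fin P), ringWeight K P S * (if A ⊆ S then 1 else 0)
      ≤ ((K : ℝ) / P) ^ A.card := by
  have hc : (0 : ℝ) < (P.choose K : ℝ) := by exact_mod_cast Nat.choose_pos hKP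
  have hP' : (0 : ℝ) < P := by exact_mod_cast hP
  set F : Finset (Finset (Fin P)) := Finset.univ.filter fun S => S.card = K ∧ A ⊆ S with hF
  have e : ∑ S : Finset (Fin P), ringWeight K P S * (if A ⊆ S then 1 else 0)
      = (F.card : ℝ) * (P.choose K : ℝ)⁻¹ := by
    rw [← nsmul_eq_mul, ← Finset.sum_const, hF, Finset.sum_filter]
    refine Finset.sum_congr rfl fun S _ => ?_
    by_cases h1 : S.card = K <;> by_cases h2 : A ⊆ S <;> simp [ringWeight, h1, h2]
  rw [e, ← div_eq_mul_inv, div_le_iff₀ hc]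
  rcases lt_or_ge K A.card with hA | hA
  · have : F = ∅ := by
      rw [hF, Finset.filter_eq_empty_iff]
      rintro S - ⟨h1, h2⟩
      have := Finset.card_le_card h2
      omega
    rw [this]
    simp only [Finset.card_empty, Nat.cast_zero]
    positivity
  · have hcard : F.card ≤ (P - A.card).choose (K - A.card) := by
      have : ((Finset.univ \ A).powersetCard (K - A.card)).card
          = (P - A.card).choose (K - A.card) := by
        rw [Finset.card_powersetCard, Finset.card_sdiff_of_subset (Finset.subset_univ A)]
        simp
      rw [← this]
      refine Finset.card_le_card_of_injOn (fun S => S \ A) ?_ ?_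
      · intro S hS
        simp only [hF, Finset.coe_filter, Finset.mem_univ, true_and, Set.mem_ofPred_eq] at hS
        simp only [Finset.mem_coe, Finset.mem_powersetCard]
        exact ⟨Finset.sdiff_subset_sdiff (Finset.subset_univ S) le_rfl,
          by rw [Finset.card_sdiff_of_subset hS.2, hS.1]⟩
      · intro S hS T hT hST
        simp only [hF, Finset.coe_filter, Finset.mem_univ, true_and, Set.mem_ofPred_eq] at hS hT
        rw [← Finset.sdiff_union_of_subset hS.2, ← Finset.sdiff_union_of_subset hT.2]
        simp only at hST
        rw [hST]
    have h1 : (F.card : ℝ) ≤ ((P - A.card).choose (K - A.card) : ℝ) := by exact_mod_cast hcard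
    refine h1.trans ?_
    have h2 := choose_le_pow_mul_choose_add ((K : ℝ) / P) (by positivity)
      (by rw [div_le_one hP']; exact_mod_cast hKP) A.card (P - A.card) (K - A.card)
    rw [Nat.sub_add_cancel hA, Nat.sub_add_cancel (hA.trans hKP)] at h2
    refine h2 ?_
    rw [div_mul_cancel₀ _ hP'.ne']

/-- Two distinct independent key rings: exponential moment of the overlap. -/
theorem sum_prod_ringWeight_mul_exp_card_inter_le {K P m : ℕ} (hP : 0 < P) (hKP : K ≤ P)
    {i j : Fin m} (hij : i ≠ j) {b : ℝ} (hb : 0 ≤ b) :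
    ∑ f : Fin m → Finset (Fin P), (∏ k, ringWeight K P (f k)) *
        Real.exp (b * ((f i ∩ f j).card : ℝ))
      ≤ Real.exp ((K : ℝ) ^ 2 / P * (Real.exp b - 1)) := by
  have hP' : (0 : ℝ) < P := by exact_mod_cast hP
  set z : ℝ := Real.exp b - 1 with hz
  have hz0 : 0 ≤ z := by linarith [Real.add_one_le_exp b]
  have hexp : ∀ T : Finset (Fin P), Real.exp (b * (T.card : ℝ))
      = ∑ A : Finset (Fin P), z ^ A.card * (if A ⊆ T then 1 else 0) := by
    intro T
    have h1 : Real.exp (b * (T.card : ℝ)) = ∏ _x ∈ T, (1 + z) := by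
      rw [Finset.prod_const, hz, add_sub_cancel, ← Real.exp_nat_mul, mul_comm]
    rw [h1, Finset.prod_one_add]
    simp only [Finset.prod_const, mul_ite, mul_one, mul_zero]
    rw [← Finset.sum_filter]
    refine Finset.sum_congr ?_ fun _ _ => rfl
    ext A
    simp
  have hfac : ∀ A : Finset (Fin P),
      ∑ f : Fin m → Finset (Fin P), (∏ k, ringWeight K P (f k)) *
        (if A ⊆ f i ∩ f j then 1 else 0)
      = (∑ S : Finset (Fin P), ringWeight K P S * (if A ⊆ S then 1 else 0)) ^ 2 := by
    intro A
    set h : Fin m → Finset (Fin P) → ℝ := fun k S =>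
      ringWeight K P S * (if k = i ∨ k = j then (if A ⊆ S then 1 else 0) else 1) with hh
    have e1 : ∀ f : Fin m → Finset (Fin P), (∏ k, ringWeight K P (f k)) *
        (if A ⊆ f i ∩ f j then 1 else 0) = ∏ k, h k (f k) := by
      intro f
      simp only [hh]
      rw [Finset.prod_mul_distrib]
      congr 1
      rw [← Finset.prod_filter]
      have : (Finset.univ.filter fun k : Fin m => k = i ∨ k = j) = {i, j} := by
        ext k
        simp
      rw [this, Finset.prod_pair hij]
      by_cases h1 : A ⊆ f i <;> by_cases h2 : A ⊆ f j <;> simp [Finset.subset_inter_iff, h1, h2]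
    simp only [e1]
    rw [← Fintype.piFinset_univ, ← Finset.prod_univ_sum]
    have e2 : ∀ k, ∑ S, h k S = if k = i ∨ k = j then
        (∑ S : Finset (Fin P), ringWeight K P S * (if A ⊆ S then 1 else 0)) else 1 := by
      intro k
      by_cases hk : k = i ∨ k = j
      · simp only [hh, hk, if_true]
      · simp only [hh, hk, if_false, mul_one]
        exact sum_ringWeight hKP
    simp only [e2]
    rw [← Finset.prod_filter]
    have : (Finset.univ.filter fun k : Fin m => k = i ∨ k = j) = {i, j} := by
      ext k
      simp
    rw [this, Finset.prod_pair hij, sq]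
  calc ∑ f : Fin m → Finset (Fin P), (∏ k, ringWeight K P (f k)) *
        Real.exp (b * ((f i ∩ f j).card : ℝ))
      = ∑ A : Finset (Fin P), z ^ A.card *
          (∑ S : Finset (Fin P), ringWeight K P S * (if A ⊆ S then 1 else 0)) ^ 2 := by
        simp only [hexp, ← hfac, Finset.mul_sum]
        rw [Finset.sum_comm]
        refine Finset.sum_congr rfl fun A _ => Finset.sum_congr rfl fun f _ => ?_
        ring
    _ ≤ ∑ A : Finset (Fin P), (z * ((K : ℝ) / P) ^ 2) ^ A.card * 1 ^ (P - A.card) := by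
        refine Finset.sum_le_sum fun A _ => ?_
        rw [one_pow, mul_one, mul_pow, ← pow_mul, mul_comm 2, pow_mul]
        refine mul_le_mul_of_nonneg_left ?_ (by positivity)
        refine pow_le_pow_left₀ (Finset.sum_nonneg fun S _ => ?_)
          (sum_ringWeight_superset_le hP hKP A) 2
        exact mul_nonneg (ringWeight_nonneg K P S) (by split_ifs <;> norm_num)
    _ = (z * ((K : ℝ) / P) ^ 2 + 1) ^ P := Fin.sum_pow_mul_eq_add_pow _ _
    _ ≤ Real.exp (z * ((K : ℝ) / P) ^ 2) ^ P :=
        pow_le_pow_left₀ (by positivity) (Real.add_one_le_exp _) P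
    _ = Real.exp ((K : ℝ) ^ 2 / P * z) := by
        rw [← Real.exp_nat_mul]
        congr 1
        field_simp

/-- Convexity of `exp` reduces the expectation over all pairs to that over a single pair. -/
theorem sum_prod_ringWeight_mul_exp_pairs_le {K P m : ℕ} (hm : 2 ≤ m) (hP : 0 < P) (hKP : K ≤ P)
    {a b : ℝ} (hab : a ≤ b) (hb : 0 ≤ b) :
    ∑ f : Fin m → Finset (Fin P), (∏ k, ringWeight K P (f k)) *
        Real.exp (a * ∑ pr ∈ Finset.univ.filter (fun pr : Fin m × Fin m => pr.1 < pr.2),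
          ((f pr.1 ∩ f pr.2).card : ℝ))
      ≤ Real.exp ((K : ℝ) ^ 2 / P * (Real.exp ((m : ℝ) ^ 2 * b) - 1)) := by
  set s := Finset.univ.filter (fun pr : Fin m × Fin m => pr.1 < pr.2) with hs
  have hne : s.Nonempty := ⟨(⟨0, by omega⟩, ⟨1, by omega⟩), by simp [hs]⟩
  have hM : (0 : ℝ) < s.card := by exact_mod_cast hne.card_pos
  have hMm : (s.card : ℝ) ≤ (m : ℝ) ^ 2 := by
    have : s.card ≤ m * m := by simpa using Finset.card_le_univ s
    rw [sq]
    exact_mod_cast this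
  have hjensen : ∀ f : Fin m → Finset (Fin P),
      Real.exp (a * ∑ pr ∈ s, ((f pr.1 ∩ f pr.2).card : ℝ))
        ≤ ∑ pr ∈ s, (s.card : ℝ)⁻¹ *
          Real.exp ((m : ℝ) ^ 2 * b * ((f pr.1 ∩ f pr.2).card : ℝ)) := by
    intro f
    have h := convexOn_exp.map_sum_le (t := s) (w := fun _ => (s.card : ℝ)⁻¹)
      (p := fun pr => (s.card : ℝ) * a * ((f pr.1 ∩ f pr.2).card : ℝ))
      (fun _ _ => by positivity) (by simp [hM.ne']) (fun _ _ => Set.mem_univ _)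
    simp only [smul_eq_mul] at h
    have e : ∑ pr ∈ s, (s.card : ℝ)⁻¹ * ((s.card : ℝ) * a * ((f pr.1 ∩ f pr.2).card : ℝ))
        = a * ∑ pr ∈ s, ((f pr.1 ∩ f pr.2).card : ℝ) := by
      rw [Finset.mul_sum]
      refine Finset.sum_congr rfl fun _ _ => ?_
      field_simp
    rw [e] at h
    refine h.trans (Finset.sum_le_sum fun pr _ => ?_)
    have h1 : (s.card : ℝ) * a ≤ (m : ℝ) ^ 2 * b :=
      (mul_le_mul_of_nonneg_left hab hM.le).trans (mul_le_mul_of_nonneg_right hMm hb)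
    gcongr
  calc _ ≤ ∑ f : Fin m → Finset (Fin P), (∏ k, ringWeight K P (f k)) *
        ∑ pr ∈ s, (s.card : ℝ)⁻¹ *
          Real.exp ((m : ℝ) ^ 2 * b * ((f pr.1 ∩ f pr.2).card : ℝ)) :=
        Finset.sum_le_sum fun f _ => mul_le_mul_of_nonneg_left (hjensen f)
          (Finset.prod_nonneg fun k _ => ringWeight_nonneg K P _)
    _ = ∑ pr ∈ s, (s.card : ℝ)⁻¹ * ∑ f : Fin m → Finset (Fin P), (∏ k, ringWeight K P (f k)) *
          Real.exp ((m : ℝ) ^ 2 * b * ((f pr.1 ∩ f pr.2).card : ℝ)) := by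
        simp only [Finset.mul_sum]
        rw [Finset.sum_comm]
        refine Finset.sum_congr rfl fun _ _ => Finset.sum_congr rfl fun _ _ => ?_
        ring
    _ ≤ ∑ _pr ∈ s, (s.card : ℝ)⁻¹ *
          Real.exp ((K : ℝ) ^ 2 / P * (Real.exp ((m : ℝ) ^ 2 * b) - 1)) := by
        refine Finset.sum_le_sum fun pr hpr => mul_le_mul_of_nonneg_left ?_ (by positivity)
        refine sum_prod_ringWeight_mul_exp_card_inter_le hP hKP ?_ (by positivity)
        exact (Finset.mem_filter.mp hpr).2.ne
    _ = _ := by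
        rw [Finset.sum_const, nsmul_eq_mul, mul_inv_cancel_left₀ hM.ne']

theorem choose_le_choose_sub_add_mul (A r s : ℕ) (hs : s ≤ A) :
    A.choose (r + 1) ≤ (A - s).choose (r + 1) + s * (A - 1).choose r := by
  induction s with
  | zero => simp
  | succ s ih =>
    obtain ⟨t, rfl⟩ : ∃ t, A = s + 1 + t := ⟨A - (s + 1), by omega⟩
    have e1 : s + 1 + t - s = t + 1 := by omega
    have e2 : s + 1 + t - (s + 1) = t := by omega
    have ih := ih (by omega)
    rw [e1, Nat.choose_succ_succ'] at ih
    rw [e2, add_mul, one_mul]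
    have : t.choose r ≤ (s + 1 + t - 1).choose r := Nat.choose_le_choose r (by omega)
    omega

theorem choose_le_two_mul_choose_sub (A r s : ℕ) (hs : s ≤ A) (h : 2 * (s * r) ≤ A) :
    A.choose r ≤ 2 * (A - s).choose r := by
  rcases r with _ | r
  · simp
  rcases A with _ | A
  · simp
  have h1 := choose_le_choose_sub_add_mul (A + 1) r s hs
  have h2 := Nat.add_one_mul_choose_eq A r
  simp only [Nat.add_sub_cancel] at h1
  have h3 : 2 * (s * A.choose r) ≤ (A + 1).choose (r + 1) := by
    refine Nat.le_of_mul_le_mul_left ?_ (Nat.succ_pos A)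
    calc (A + 1) * (2 * (s * A.choose r)) = 2 * s * ((A + 1) * A.choose r) := by ring
      _ = 2 * (s * (r + 1)) * (A + 1).choose (r + 1) := by rw [h2]; ring
      _ ≤ _ := Nat.mul_le_mul_right _ h
  omega

/-- Sharing at least `q` keys is at least as likely as sharing exactly `q` keys. -/
theorem le_psq {q K P : ℕ} (hqK : q ≤ K) (hKP : K ≤ P) :
    ((K.choose q : ℝ) * ((P - K).choose (K - q) : ℝ)) / (P.choose K : ℝ) ≤ psq q K P := by
  have hc : (0 : ℝ) < (P.choose K : ℝ) := by exact_mod_cast Nat.choose_pos hKP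
  have hv : ∑ u ∈ Finset.range (K + 1), (K.choose u) * ((P - K).choose (K - u)) = P.choose K := by
    have := Nat.add_choose_eq K (P - K) K
    rw [Nat.add_sub_cancel' hKP, Finset.Nat.sum_antidiagonal_eq_sum_range_succ_mk] at this
    exact this.symm
  have hle : ∑ u ∈ Finset.range (q + 1), (K.choose u) * ((P - K).choose (K - u)) ≤ P.choose K := by
    rw [← hv]
    exact Finset.sum_le_sum_of_subset (Finset.range_mono (by omega))
  have hle' : ∑ u ∈ Finset.range (q + 1), ((K.choose u : ℝ) * ((P - K).choose (K - u) : ℝ))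
      ≤ (P.choose K : ℝ) := by exact_mod_cast hle
  unfold psq
  rw [← Finset.sum_div, div_le_iff₀ hc, sub_mul, div_mul_cancel₀ _ hc.ne']
  rw [Finset.sum_range_succ] at hle'
  linarith

theorem pow_le_mul_psq {q K P : ℕ} (hK : 1 ≤ K) (hqK : 2 * q ≤ K) (hKP : 4 * K ^ 2 ≤ P) :
    ((K : ℝ) ^ 2 / P) ^ q ≤ 2 * 4 ^ q * (q.factorial : ℝ) ^ 2 * psq q K P := by
  have hKK : K ≤ K ^ 2 := by nlinarith
  have hP0 : (0 : ℝ) < P := by exact_mod_cast (by nlinarith : 0 < P)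
  have hc : (0 : ℝ) < (P.choose K : ℝ) := by exact_mod_cast Nat.choose_pos (by omega : K ≤ P)
  have hl := le_psq (q := q) (K := K) (P := P) (by omega) (by omega)
  have h1 : (P.choose K : ℝ) * (K.choose q : ℝ)
      = (P.choose q : ℝ) * ((P - q).choose (K - q) : ℝ) := by
    exact_mod_cast Nat.choose_mul (n := P) (by omega : q ≤ K)
  have h2 : ((P - q).choose (K - q) : ℝ) ≤ 2 * ((P - K).choose (K - q) : ℝ) := by
    have := choose_le_two_mul_choose_sub (P - q) (K - q) (K - q) (by omega) (by
      have : (K - q) * (K - q) ≤ K ^ 2 := by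
        rw [sq]; exact Nat.mul_le_mul (Nat.sub_le _ _) (Nat.sub_le _ _)
      omega)
    rw [show P - q - (K - q) = P - K by omega] at this
    exact_mod_cast this
  have h3 : (P.choose q : ℝ) ≤ (P : ℝ) ^ q := by exact_mod_cast Nat.choose_le_pow P q
  have h4 : ((K : ℝ) / 2) ^ q ≤ (q.factorial : ℝ) * (K.choose q : ℝ) := by
    have h := Nat.pow_le_choose (α := ℝ) q K
    rw [div_le_iff₀' (by positivity)] at h
    refine le_trans (pow_le_pow_left₀ (by positivity) ?_ q) h
    rw [Nat.cast_sub (by omega)]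
    have : (2 : ℝ) * q ≤ K := by exact_mod_cast hqK
    push_cast
    linarith
  have h5 : (K.choose q : ℝ) ^ 2 ≤ 2 * (P : ℝ) ^ q *
      (((K.choose q : ℝ) * ((P - K).choose (K - q) : ℝ)) / (P.choose K : ℝ)) := by
    rw [← mul_div_assoc, le_div_iff₀ hc]
    calc (K.choose q : ℝ) ^ 2 * (P.choose K : ℝ)
        = (K.choose q : ℝ) * ((P.choose K : ℝ) * (K.choose q : ℝ)) := by ring
      _ = (K.choose q : ℝ) * ((P.choose q : ℝ) * ((P - q).choose (K - q) : ℝ)) := by rw [h1]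
      _ ≤ (K.choose q : ℝ) * ((P : ℝ) ^ q * (2 * ((P - K).choose (K - q) : ℝ))) := by gcongr
      _ = _ := by ring
  have h6 : (K.choose q : ℝ) ^ 2 ≤ 2 * (P : ℝ) ^ q * psq q K P :=
    h5.trans (mul_le_mul_of_nonneg_left hl (by positivity))
  rw [div_pow, div_le_iff₀ (by positivity)]
  calc ((K : ℝ) ^ 2) ^ q = 4 ^ q * (((K : ℝ) / 2) ^ q) ^ 2 := by
        rw [← pow_mul ((K : ℝ) / 2), mul_comm q 2, pow_mul ((K : ℝ) / 2), ← mul_pow]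
        congr 1
        ring
    _ ≤ 4 ^ q * ((q.factorial : ℝ) * (K.choose q : ℝ)) ^ 2 := by gcongr
    _ = 4 ^ q * (q.factorial : ℝ) ^ 2 * (K.choose q : ℝ) ^ 2 := by ring
    _ ≤ 4 ^ q * (q.factorial : ℝ) ^ 2 * (2 * (P : ℝ) ^ q * psq q K P) := by gcongr
    _ = _ := by ring

/-- The quantitative estimate behind the asymptotics: `L` stands for `log n`, `x` for `K ^ 2 / P`,
and `s` for the probability of sharing at least `q` keys. -/
theorem mul_exp_le_of_small_or_large_prob {q : ℕ} (hq : 1 ≤ q)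
    {x s p N L B C D k δ : ℝ} (hx : 0 ≤ x) (hp1 : p ≤ 1) (hL : 0 < L)
    (hN : N = Real.exp L) (hB : 0 ≤ B) (hC : 0 ≤ C) (hD : 0 ≤ D) (hk : 1 ≤ k)
    (hkB : 2 * q * B ≤ k) (hδ : 0 ≤ δ)
    (hxs : x ^ q ≤ D * s) (hs : N * (p * s) ≤ C * L)
    (hsmall : x * Real.exp B ≤ δ)
    (hlarge : D * C * L ^ 2 * Real.exp (-(L / 2)) ≤ δ ^ q) :
    x * Real.exp (B * (L * p / k)) ≤ δ := by
  have hk0 : 0 < k := by linarith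
  rcases le_or_gt (L * p) 1 with h | h
  · refine le_trans (mul_le_mul_of_nonneg_left (Real.exp_le_exp.mpr ?_) hx) hsmall
    have : L * p / k ≤ 1 := by
      rw [div_le_one hk0]
      linarith
    nlinarith
  · refine le_of_pow_le_pow_left₀ (by omega : q ≠ 0) hδ (le_trans ?_ hlarge)
    have hs0 : 0 ≤ D * s := le_trans (by positivity) hxs
    have hNpos : 0 < N := hN ▸ Real.exp_pos L
    have h1 : N * (D * s) ≤ D * C * L ^ 2 := by
      calc N * (D * s) ≤ N * (D * s) * (L * p) := le_mul_of_one_le_right (by positivity) h.le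
        _ = D * L * (N * (p * s)) := by ring
        _ ≤ D * L * (C * L) := by gcongr
        _ = _ := by ring
    have h2 : x ^ q ≤ D * C * L ^ 2 * Real.exp (-L) := by
      rw [Real.exp_neg, ← hN, ← div_eq_mul_inv, le_div_iff₀ hNpos]
      nlinarith
    have h3 : q * (B * (L * p / k)) ≤ L / 2 := by
      rw [← mul_div_assoc, ← mul_div_assoc, div_le_iff₀ hk0]
      have : B * (L * p) ≤ B * L :=
        mul_le_mul_of_nonneg_left (by nlinarith) hB
      have hq0 : (0 : ℝ) ≤ q := by positivity
      nlinarith [mul_le_mul_of_nonneg_left this hq0]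
    calc (x * Real.exp (B * (L * p / k))) ^ q
        = x ^ q * Real.exp (q * (B * (L * p / k))) := by rw [mul_pow, ← Real.exp_nat_mul]
      _ ≤ D * C * L ^ 2 * Real.exp (-L) * Real.exp (L / 2) := by gcongr
      _ = D * C * L ^ 2 * Real.exp (-(L / 2)) := by
        rw [mul_assoc, ← Real.exp_add]
        congr 2
        ring

/-- if `K_n → ∞`, `K_n²/P_n → 0` and `(n p_{e,q}(n) − ln n)/ln ln n`
is bounded, then
`E[exp((n p_{e,q}(n) p_n/K_n) Σ_{1≤i<j≤m} |S_i ∩ S_j|)] ≤ 1 + o(1)`,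
i.e. for every `ε > 0` the expectation is at most `1 + ε` eventually. -/
theorem exp_overlap_expectation_le_one_plus_o_one
    (q m : ℕ) (hq : 1 ≤ q) (hm : 2 ≤ m)
    (K P : ℕ → ℕ) (p : ℕ → ℝ)
    (hK1 : ∀ n, 1 ≤ K n) (hKP : ∀ n, K n ≤ P n)
    (hp : ∀ n, p n ∈ Set.Ioc (0 : ℝ) 1)
    (hKinf : Tendsto (fun n => (K n : ℝ)) atTop atTop)
    (hKsqP : Tendsto (fun n => ((K n : ℝ)) ^ 2 / (P n : ℝ)) atTop (nhds 0))
    (hbounded : ∃ C : ℝ, ∀ᶠ (n : ℕ) in atTop,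
      |((n : ℝ) * peq q (K n) (P n) (p n) - Real.log (n : ℝ)) / Real.log (Real.log (n : ℝ))| ≤ C) :
    ∀ ε : ℝ, 0 < ε → ∀ᶠ (n : ℕ) in atTop,
      expExpectation q m K P p n ≤ 1 + ε := by
  intro ε hε
  obtain ⟨C₀, hC₀⟩ := hbounded
  set C : ℝ := 1 + |C₀| with hC
  have hCpos : 0 < C := by positivity
  set B : ℝ := (m : ℝ) ^ 2 * C with hB
  set D : ℝ := 2 * 4 ^ q * (q.factorial : ℝ) ^ 2 with hD
  set δ : ℝ := Real.log (1 + ε) with hδ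
  have hδpos : 0 < δ := Real.log_pos (by linarith)
  have hlog : Tendsto (fun n : ℕ => Real.log (n : ℝ)) atTop atTop :=
    Real.tendsto_log_atTop.comp tendsto_natCast_atTop_atTop
  have hdecay : Tendsto (fun n : ℕ => D * C * Real.log (n : ℝ) ^ 2 *
      Real.exp (-(Real.log (n : ℝ) / 2))) atTop (nhds 0) := by
    have h0 := ((Real.tendsto_pow_mul_exp_neg_atTop_nhds_zero 2).comp
      ((hlog.atTop_div_const (r := 2) (by norm_num)))).const_mul (D * C * 4)
    rw [mul_zero] at h0
    refine h0.congr fun n => ?_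
    simp only [Function.comp]
    ring
  have hxB : Tendsto (fun n => ((K n : ℝ)) ^ 2 / (P n : ℝ) * Real.exp B) atTop (nhds 0) := by
    simpa using hKsqP.mul_const (Real.exp B)
  filter_upwards [hC₀, hlog.eventually_gt_atTop 1,
    (Real.tendsto_log_atTop.comp hlog).eventually_gt_atTop 0,
    hKinf.eventually_ge_atTop (2 * q * B), hKinf.eventually_ge_atTop (2 * q),
    hKsqP.eventually_le_const (show (0 : ℝ) < 1 / 4 by norm_num),
    hxB.eventually_le_const hδpos,
    hdecay.eventually_le_const (show (0 : ℝ) < δ ^ q by positivity), eventually_gt_atTop 0]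
    with n hn hL hLL hKB hKq hx4 hxδ hlarge hn0
  set L : ℝ := Real.log (n : ℝ) with hLdef
  have hn0' : (0 : ℝ) < n := by exact_mod_cast hn0
  have hP : 0 < P n := lt_of_lt_of_le (hK1 n) (hKP n)
  have hP' : (0 : ℝ) < P n := by exact_mod_cast hP
  have hK1' : (1 : ℝ) ≤ K n := by exact_mod_cast hK1 n
  obtain ⟨hp0, hp1⟩ := hp n
  have hpe : (n : ℝ) * peq q (K n) (P n) (p n) ≤ C * L := by
    simp only [Function.comp] at hLL
    rw [abs_div, abs_of_pos hLL, div_le_iff₀ hLL] at hn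
    have h1 : Real.log L ≤ L := (Real.log_le_sub_one_of_pos (by linarith)).trans (by linarith)
    have h2 : C₀ * Real.log L ≤ |C₀| * L :=
      (mul_le_mul_of_nonneg_right (le_abs_self C₀) hLL.le).trans
        (mul_le_mul_of_nonneg_left h1 (abs_nonneg C₀))
    have h3 := (le_abs_self _).trans hn
    rw [hC]
    linarith
  have hpsq : ((K n : ℝ) ^ 2 / P n) ^ q ≤ D * psq q (K n) (P n) := by
    refine pow_le_mul_psq (hK1 n) (by exact_mod_cast hKq) ?_
    rw [div_le_iff₀ hP'] at hx4
    have : (4 : ℝ) * (K n : ℝ) ^ 2 ≤ P n := by linarith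
    exact_mod_cast this
  have hkey := mul_exp_le_of_small_or_large_prob hq (x := (K n : ℝ) ^ 2 / P n)
    (s := psq q (K n) (P n)) (N := n) (L := L) (B := B) (C := C) (D := D) (k := K n)
    (by positivity) hp1 (by linarith) (Real.exp_log hn0').symm (by positivity) hCpos.le
    (by positivity) hK1' hKB hδpos.le hpsq hpe hxδ hlarge
  have hb0 : 0 ≤ C * (L * p n / K n) := by positivity
  have hab : (n : ℝ) * peq q (K n) (P n) (p n) * p n / (K n : ℝ) ≤ C * (L * p n / K n) := by
    rw [← mul_div_assoc, ← mul_assoc]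
    gcongr
  refine (sum_prod_ringWeight_mul_exp_pairs_le hm hP (hKP n) hab hb0).trans ?_
  rw [← Real.exp_log (show 0 < 1 + ε by linarith), ← hδ, ← mul_assoc, ← hB]
  refine Real.exp_le_exp.mpr (le_trans ?_ hkey)
  refine mul_le_mul_of_nonneg_left ?_ (by positivity)
  linarith
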